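/- There exists a constant λ̄ > 0 (depending only on Λ, α, β) such that for every admissible function x : [0,1] → ℝⁿ satisfying the Sturm–Liouville boundary conditions, ∫₀¹ ⟨(d/dt)(Λ(t)x′(t)), x(t)⟩ dt ≤ λ̄ ∫₀¹ ‖x(t)‖² dt. -/

import Mathlib

open scoped RealInnerProductSpace

/-- A function `x : [0,1] → ℝⁿ` is admissible if `x` is `C¹` on `[0,1]` and
`t ↦ Λ(t) x′(t)` is `C¹` on `[0,1]`.  Derivatives on `[0,1]` are taken with `derivWithin`. -/
def SLadmissible (n : ℕ) (Λ : ℝ → Matrix (Fin n) (Fin n) ℝ)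
    (x : ℝ → EuclideanSpace ℝ (Fin n)) : Prop :=
  ContDiffOn ℝ 1 x (Set.Icc 0 1) ∧
  ContDiffOn ℝ 1
    (fun t => Matrix.toEuclideanLin (Λ t) (derivWithin x (Set.Icc 0 1) t)) (Set.Icc 0 1)

/-- The Sturm–Liouville boundary conditions
`cos α · x(0) − sin α · Λ(0)x′(0) = 0` and `cos β · x(1) − sin β · Λ(1)x′(1) = 0`. -/
def SLbc (n : ℕ) (Λ : ℝ → Matrix (Fin n) (Fin n) ℝ) (α β : ℝ)
    (x : ℝ → EuclideanSpace ℝ (Fin n)) : Prop :=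
  Real.cos α • x 0 -
      Real.sin α • Matrix.toEuclideanLin (Λ 0) (derivWithin x (Set.Icc 0 1) 0) = 0 ∧
  Real.cos β • x 1 -
      Real.sin β • Matrix.toEuclideanLin (Λ 1) (derivWithin x (Set.Icc 0 1) 1) = 0

/-- The solution set `Sol(B)` of the linear Sturm–Liouville boundary value problem
`(Λ(t)x′(t))′ + B(t)x(t) = 0` on `[0,1]` with the boundary conditions. -/
def SLsol (n : ℕ) (Λ : ℝ → Matrix (Fin n) (Fin n) ℝ) (α β : ℝ)
    (B : ℝ → Matrix (Fin n) (Fin n) ℝ) : Set (ℝ → EuclideanSpace ℝ (Fin n)) :=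
  {x | SLadmissible n Λ x ∧ SLbc n Λ α β x ∧
    ∀ t ∈ Set.Icc (0:ℝ) 1,
      derivWithin (fun s => Matrix.toEuclideanLin (Λ s) (derivWithin x (Set.Icc 0 1) s))
          (Set.Icc 0 1) t + Matrix.toEuclideanLin (B t) (x t) = 0}

/-- The nullity `ν(B) := dim Sol(B)` (realized as the rank of the span of the solution set,
which coincides with `dim Sol(B)` since `Sol(B)` is a linear subspace). -/
noncomputable def SLnu (n : ℕ) (Λ : ℝ → Matrix (Fin n) (Fin n) ℝ) (α β : ℝ)
    (B : ℝ → Matrix (Fin n) (Fin n) ℝ) : ℕ :=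
  Module.finrank ℝ (Submodule.span ℝ (SLsol n Λ α β B))

/-- The index `i(B) := Σ_{μ < 0} ν(B + μIₙ)`, the sum taken in `ℕ ∪ {∞}`. -/
noncomputable def SLidx (n : ℕ) (Λ : ℝ → Matrix (Fin n) (Fin n) ℝ) (α β : ℝ)
    (B : ℝ → Matrix (Fin n) (Fin n) ℝ) : ℕ∞ :=
  ∑' μ : (Set.Iio (0:ℝ)),
    (SLnu n Λ α β (fun t => B t + (μ : ℝ) • (1 : Matrix (Fin n) (Fin n) ℝ)) : ℕ∞)

/-- A continuous family of positive definite matrices on a compact set is uniformly coercive. -/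
theorem exists_pos_forall_mul_sq_norm_le_inner_toEuclideanLin {X : Type*} [TopologicalSpace X]
    {n : ℕ} {K : Set X} (hK : IsCompact K) {Λ : X → Matrix (Fin n) (Fin n) ℝ}
    (hcont : ContinuousOn Λ K) (hpos : ∀ t ∈ K, (Λ t).PosDef) :
    ∃ c : ℝ, 0 < c ∧ ∀ t ∈ K, ∀ v : EuclideanSpace ℝ (Fin n),
      c * ‖v‖ ^ 2 ≤ ⟪Matrix.toEuclideanLin (Λ t) v, v⟫ := by
  have hinner : ∀ t (v : EuclideanSpace ℝ (Fin n)),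
      ⟪Matrix.toEuclideanLin (Λ t) v, v⟫ = v.ofLp ⬝ᵥ (Λ t).mulVec v.ofLp := by
    intro t v
    simp [EuclideanSpace.inner_eq_star_dotProduct, Matrix.toLpLin_apply]
  have hc : ContinuousOn (fun p : X × EuclideanSpace ℝ (Fin n) =>
      ⟪Matrix.toEuclideanLin (Λ p.1) p.2, p.2⟫) (K ×ˢ Metric.sphere 0 1) := by
    simp only [hinner, dotProduct, Matrix.mulVec]
    have hcoord : ∀ i, ContinuousOn (fun p : X × EuclideanSpace ℝ (Fin n) => p.2.ofLp i)
        (K ×ˢ Metric.sphere 0 1) := fun i => by fun_prop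
    have hentry : ∀ i j, ContinuousOn (fun p : X × EuclideanSpace ℝ (Fin n) => Λ p.1 i j)
        (K ×ˢ Metric.sphere 0 1) := fun i j =>
      (continuous_apply_apply i j).comp_continuousOn
        (hcont.comp continuousOn_fst fun p hp => hp.1)
    exact continuousOn_finsetSum _ fun i _ => (hcoord i).mul <|
      continuousOn_finsetSum _ fun j _ => (hentry i j).mul (hcoord j)
  obtain ⟨c, hc0, hle⟩ := (hK.prod (isCompact_sphere _ _)).exists_forall_le' hc (a := 0) (by
    rintro ⟨t, v⟩ ⟨ht, hv⟩
    have hv0 : v.ofLp ≠ 0 := by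
      intro h
      have : v = 0 := by ext i; exact congrFun h i
      simp [this] at hv
    simpa [hinner] using (hpos t ht).dotProduct_mulVec_pos hv0)
  refine ⟨c, hc0, fun t ht v => ?_⟩
  rcases eq_or_ne v 0 with rfl | hv
  · simp
  have h := hle (t, ‖v‖⁻¹ • v) ⟨ht, by simp [norm_smul, hv]⟩
  simp only [map_smul, inner_smul_left, inner_smul_right, RCLike.conj_to_real] at h
  have hn : 0 < ‖v‖ := norm_pos_iff.2 hv
  calc c * ‖v‖ ^ 2
      ≤ (‖v‖⁻¹ * (‖v‖⁻¹ * ⟪Matrix.toEuclideanLin (Λ t) v, v⟫)) * ‖v‖ ^ 2 := by gcongr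
    _ = _ := by field_simp

/-- A separated boundary condition bounds the boundary term by the squared norm. -/
theorem abs_inner_le_abs_cot_mul_sq_norm {E : Type*} [NormedAddCommGroup E]
    [InnerProductSpace ℝ E] {θ : ℝ} {u v : E}
    (h : Real.cos θ • u - Real.sin θ • v = 0) :
    |⟪v, u⟫| ≤ |Real.cos θ / Real.sin θ| * ‖u‖ ^ 2 := by
  by_cases hs : Real.sin θ = 0
  · have hcos : Real.cos θ ≠ 0 := fun hc => by
      have := Real.sin_sq_add_cos_sq θ
      simp [hs, hc] at this
    have hu : u = 0 := by simpa [hs, hcos] using h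
    simp [hu]
  · have hv : v = (Real.cos θ / Real.sin θ) • u := by
      rw [div_eq_inv_mul, mul_smul, sub_eq_zero.1 h, smul_smul, inv_mul_cancel₀ hs, one_smul]
    rw [hv, inner_smul_left, real_inner_self_eq_norm_sq, abs_mul, abs_of_nonneg (sq_nonneg ‖u‖)]
    simp

/-- **Lemma 3.1.** There is `λ̄ > 0`, depending only on `Λ, α, β`, with
`∫₀¹ ⟪(Λx′)′(t), x(t)⟫ dt ≤ λ̄ ∫₀¹ ‖x(t)‖² dt` for every admissible `x` satisfying the
Sturm–Liouville boundary conditions. -/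
theorem statement16
    (n : ℕ) (hn : 1 ≤ n)
    (Λ : ℝ → Matrix (Fin n) (Fin n) ℝ)
    (hΛ_cont : ContinuousOn Λ (Set.Icc 0 1))
    (hΛ_symm : ∀ t ∈ Set.Icc (0:ℝ) 1, (Λ t).IsSymm)
    (hΛ_pos : ∀ t ∈ Set.Icc (0:ℝ) 1, (Λ t).PosDef)
    (α β : ℝ) (hα : α ∈ Set.Ico 0 Real.pi) (hβ : β ∈ Set.Ioc 0 Real.pi) :
    ∃ lam : ℝ, 0 < lam ∧
      ∀ x : ℝ → EuclideanSpace ℝ (Fin n), SLadmissible n Λ x → SLbc n Λ α β x →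
        (∫ t in (0:ℝ)..1,
            ⟪derivWithin
                (fun s => Matrix.toEuclideanLin (Λ s) (derivWithin x (Set.Icc 0 1) s))
                (Set.Icc 0 1) t, x t⟫) ≤
          lam * ∫ t in (0:ℝ)..1, ‖x t‖ ^ 2 := by
  obtain ⟨c, hc, hcoer⟩ :=
    exists_pos_forall_mul_sq_norm_le_inner_toEuclideanLin isCompact_Icc hΛ_cont hΛ_pos
  obtain ⟨C, hC, hCα, hCβ⟩ : ∃ C : ℝ, 0 < C ∧ |Real.cos α / Real.sin α| ≤ C ∧
      |Real.cos β / Real.sin β| ≤ C :=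
    ⟨|Real.cos α / Real.sin α| + |Real.cos β / Real.sin β| + 1, by positivity,
      by linarith [abs_nonneg (Real.cos β / Real.sin β)],
      by linarith [abs_nonneg (Real.cos α / Real.sin α)]⟩
  refine ⟨2 * C + C ^ 2 / c, by positivity, fun x hx hbc => ?_⟩
  obtain ⟨hx1, hy1⟩ := hx
  obtain ⟨hbc0, hbc1⟩ := hbc
  have hxd := hx1.continuousOn_derivWithin (uniqueDiffOn_Icc one_pos) le_rfl
  have hyd := hy1.continuousOn_derivWithin (uniqueDiffOn_Icc one_pos) le_rfl
  have hcoer' : ∀ t ∈ Set.Icc (0 : ℝ) 1, c * ‖derivWithin x (Set.Icc 0 1) t‖ ^ 2 ≤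
      ⟪Matrix.toEuclideanLin (Λ t) (derivWithin x (Set.Icc 0 1) t),
        derivWithin x (Set.Icc 0 1) t⟫ := fun t ht => hcoer t ht _
  have hb0 := abs_inner_le_abs_cot_mul_sq_norm hbc0
  have hb1 := abs_inner_le_abs_cot_mul_sq_norm hbc1
  have hder : ∀ {z : ℝ → EuclideanSpace ℝ (Fin n)}, ContDiffOn ℝ 1 z (Set.Icc 0 1) →
      ∀ t ∈ Set.Ioo (0 : ℝ) 1, HasDerivAt z (derivWithin z (Set.Icc 0 1) t) t :=
    fun hz t ht => ((hz.differentiableOn one_ne_zero t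
      (Set.Ioo_subset_Icc_self ht)).hasDerivWithinAt).hasDerivAt (Icc_mem_nhds ht.1 ht.2)
  have hxder := hder hx1
  have hyder := hder hy1
  have hxc := hx1.continuousOn
  have hyc := hy1.continuousOn
  set x' := derivWithin x (Set.Icc 0 1)
  set y := fun s => Matrix.toEuclideanLin (Λ s) (x' s)
  set y' := derivWithin y (Set.Icc 0 1)
  change ∀ t ∈ Set.Icc (0 : ℝ) 1, c * ‖x' t‖ ^ 2 ≤ ⟪y t, x' t⟫ at hcoer'
  change |⟪y 0, x 0⟫| ≤ _ at hb0
  change |⟪y 1, x 1⟫| ≤ _ at hb1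
  have hint : ∀ {f : ℝ → ℝ}, ContinuousOn f (Set.Icc 0 1) →
      IntervalIntegrable f MeasureTheory.volume 0 1 :=
    fun hf => hf.intervalIntegrable_of_Icc zero_le_one
  have hF'c : ContinuousOn (fun t => (⟪y t, x' t⟫ + ⟪y' t, x t⟫) -
      (2 * C * ⟪x t, x t⟫ + (2 * C * t - C) * (⟪x t, x' t⟫ + ⟪x' t, x t⟫)))
      (Set.Icc 0 1) := by fun_prop
  -- The weight `2 * C * t - C` equals `∓C` at the endpoints and absorbs the boundary terms.
  have hftc := intervalIntegral.integral_eq_sub_of_hasDerivAt_of_le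
    (f := fun t => ⟪y t, x t⟫ - (2 * C * t - C) * ⟪x t, x t⟫) zero_le_one
    (by fun_prop)
    (fun t ht => by
      have hk : HasDerivAt (fun t : ℝ => 2 * C * t - C) (2 * C) t := by
        simpa using ((hasDerivAt_id t).const_mul (2 * C)).sub_const C
      exact ((hyder t ht).inner ℝ (hxder t ht)).sub
        (hk.mul ((hxder t ht).inner ℝ (hxder t ht))))
    (hint hF'c)
  have hmono : ∫ t in (0 : ℝ)..1, ⟪y' t, x t⟫ ≤ ∫ t in (0 : ℝ)..1,
      (((⟪y t, x' t⟫ + ⟪y' t, x t⟫) -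
        (2 * C * ⟪x t, x t⟫ + (2 * C * t - C) * (⟪x t, x' t⟫ + ⟪x' t, x t⟫))) +
        (2 * C + C ^ 2 / c) * ‖x t‖ ^ 2) := by
    refine intervalIntegral.integral_mono_on zero_le_one (hint (by fun_prop))
      (hint (hF'c.add (by fun_prop))) fun t ht => ?_
    have h1 := hcoer' t ht
    have h2 : |(2 * C * t - C) * ⟪x t, x' t⟫| ≤ C * (‖x t‖ * ‖x' t‖) := by
      rw [abs_mul]
      gcongr
      · rw [abs_le]
        constructor <;> nlinarith [ht.1, ht.2]
      · exact abs_real_inner_le_norm _ _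
    have h3 : 2 * C * (‖x t‖ * ‖x' t‖) ≤ c * ‖x' t‖ ^ 2 + C ^ 2 / c * ‖x t‖ ^ 2 := by
      have : c * ‖x' t‖ ^ 2 + C ^ 2 / c * ‖x t‖ ^ 2 - 2 * C * (‖x t‖ * ‖x' t‖) =
          (c * ‖x' t‖ - C * ‖x t‖) ^ 2 / c := by
        field_simp
        ring
      have : 0 ≤ (c * ‖x' t‖ - C * ‖x t‖) ^ 2 / c := by positivity
      linarith
    rw [real_inner_comm (x t) (x' t), real_inner_self_eq_norm_sq]
    linarith [le_abs_self ((2 * C * t - C) * ⟪x t, x' t⟫)]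
  rw [intervalIntegral.integral_add (hint hF'c) (hint (by fun_prop)), hftc,
    intervalIntegral.integral_const_mul] at hmono
  simp only [real_inner_self_eq_norm_sq] at hmono
  have hB0 := mul_le_mul_of_nonneg_right hCα (sq_nonneg ‖x 0‖)
  have hB1 := mul_le_mul_of_nonneg_right hCβ (sq_nonneg ‖x 1‖)
  linarith [(abs_le.1 hb0).1, (abs_le.1 hb1).2]
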